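/- arXiv:1001.4145 — 2 statements merged into one kernel-verified Lean document; each statement's English description precedes it below -/
import Mathlib

section
/- Let v₁, …, v_k ∈ ℤⁿ be such that C' = cone(v₁, …, v_{k-1}) is full-dimensional, let C = C' + cone(v_k), and suppose v_k ∉ C'. Let F₁, …, F_q be the facets of C' visible from v_k (i.e., facets whose defining inequality is violated by v_k), with primitive integral exterior normal vectors c₁, …, c_q. Then the set H(C') ∪ {v_k} ∪ ⋃{ H(F_i + cone(v_k)) : |c_iᵀ v_k| ≥ 2 } generates the monoid C ∩ ℤⁿ, where H(·) denotes the Hilbert basis. -/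
def IsLatticePt {n : ℕ} (x : Fin n → ℝ) : Prop := ∀ i, ∃ m : ℤ, x i = (m : ℝ)

def coneOf {n k : ℕ} (v : Fin k → (Fin n → ℝ)) : Set (Fin n → ℝ) :=
  {x | ∃ lam : Fin k → ℝ, (∀ i, 0 ≤ lam i) ∧ x = ∑ i, lam i • v i}

def IsIrred {n : ℕ} (M : Set (Fin n → ℝ)) (h : Fin n → ℝ) : Prop :=
  h ∈ M ∧ h ≠ 0 ∧ ∀ a b : Fin n → ℝ, a ∈ M → b ∈ M → h = a + b → a = 0 ∨ b = 0

def HilbBasis {n : ℕ} (C : Set (Fin n → ℝ)) : Set (Fin n → ℝ) :=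
  {h | IsIrred {x | x ∈ C ∧ IsLatticePt x} h}

/-- `c` has coprime integer entries. -/
def IsPrimitive {n : ℕ} (c : Fin n → ℤ) : Prop :=
  Finset.univ.gcd (fun t => (c t).natAbs) = 1

/-- `c` is the primitive integral exterior normal vector of a facet of the
full-dimensional cone `C`: `cᵀ y ≤ 0` on `C` and the face it cuts out has dimension `n-1`. -/
def IsFacetNormal {n : ℕ} (C : Set (Fin n → ℝ)) (c : Fin n → ℤ) : Prop :=
  IsPrimitive c ∧ (∀ y ∈ C, ∑ t, (c t : ℝ) * y t ≤ 0) ∧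
    Module.finrank ℝ
      (Submodule.span ℝ {x | x ∈ C ∧ ∑ t, (c t : ℝ) * x t = 0}) = n - 1

/-- Minkowski sum `S + cone(w)`. -/
def addRay {n : ℕ} (S : Set (Fin n → ℝ)) (w : Fin n → ℝ) : Set (Fin n → ℝ) :=
  {y | ∃ x ∈ S, ∃ μ : ℝ, 0 ≤ μ ∧ y = x + μ • w}


open Matrix

lemma farkas_fin {K : Type*} [Field K] [LinearOrder K] [IsStrictOrderedRing K] {n : ℕ} (m : ℕ) :
    ∀ (a : Fin m → (Fin n → K)) (b : Fin n → K)
    (_ : ∀ x, (∀ i, a i ⬝ᵥ x ≤ 0) → b ⬝ᵥ x ≤ 0),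
    ∃ l : Fin m → K, (∀ i, 0 ≤ l i) ∧ b = ∑ i, l i • a i := by
  induction m with
  | zero =>
    intro a b h
    refine ⟨fun _ => 0, fun _ => le_rfl, ?_⟩
    have := h b (fun i => i.elim0)
    have h2 : b ⬝ᵥ b = 0 := le_antisymm this (by
      unfold dotProduct; exact Finset.sum_nonneg fun i _ => mul_self_nonneg _)
    simpa using dotProduct_self_eq_zero.1 h2
  | succ m ih =>
    intro a b h
    by_cases h0 : ∀ x, (∀ i : Fin m, a i.castSucc ⬝ᵥ x ≤ 0) → b ⬝ᵥ x ≤ 0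
    · obtain ⟨l, hl, hb⟩ := ih (fun i => a i.castSucc) b h0
      refine ⟨Fin.snoc l 0, ?_, ?_⟩
      · intro i
        refine Fin.lastCases ?_ (fun j => ?_) i
        · simp
        · simpa using hl j
      · simp [Fin.sum_univ_castSucc, hb]
    · push Not at h0
      obtain ⟨x1, hx1, hb1⟩ := h0
      have hp : 0 < a (Fin.last m) ⬝ᵥ x1 := by
        by_contra hcon
        push Not at hcon
        refine absurd (h x1 ?_) (not_le.2 hb1)
        intro i
        exact Fin.lastCases hcon hx1 i
      obtain ⟨x0, hx0, hb0, hl0⟩ : ∃ x0, (∀ i : Fin m, a i.castSucc ⬝ᵥ x0 ≤ 0) ∧ 0 < b ⬝ᵥ x0 ∧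
          a (Fin.last m) ⬝ᵥ x0 = 1 := by
        refine ⟨(a (Fin.last m) ⬝ᵥ x1)⁻¹ • x1, ?_, ?_, ?_⟩
        · intro i
          rw [dotProduct_smul, smul_eq_mul]
          exact mul_nonpos_of_nonneg_of_nonpos (inv_pos.2 hp).le (hx1 i)
        · rw [dotProduct_smul, smul_eq_mul]
          exact mul_pos (inv_pos.2 hp) hb1
        · rw [dotProduct_smul, smul_eq_mul, inv_mul_cancel₀ hp.ne']
      obtain ⟨l, hl, hb⟩ := ih
        (fun i => a i.castSucc - (a i.castSucc ⬝ᵥ x0) • a (Fin.last m))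
        (b - (b ⬝ᵥ x0) • a (Fin.last m)) (by
          intro x hx
          have := h (x - (a (Fin.last m) ⬝ᵥ x) • x0) (by
            intro i
            refine Fin.lastCases ?_ (fun j => ?_) i
            · simp [dotProduct_sub, hl0]
            · have := hx j
              simp only [sub_dotProduct, smul_dotProduct, smul_eq_mul, dotProduct_sub,
                dotProduct_smul] at this ⊢
              linarith)
          simp only [sub_dotProduct, smul_dotProduct, smul_eq_mul, dotProduct_sub,
                dotProduct_smul] at this ⊢
          linarith)
      refine ⟨Fin.snoc l (b ⬝ᵥ x0 - ∑ i, l i * (a i.castSucc ⬝ᵥ x0)), ?_, ?_⟩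
      · intro i
        refine Fin.lastCases ?_ (fun j => ?_) i
        · simp only [Fin.snoc_last, sub_nonneg]
          refine le_trans (Finset.sum_nonpos fun i _ => ?_) hb0.le
          exact mul_nonpos_of_nonneg_of_nonpos (hl i) (hx0 i)
        · simpa using hl j
      · rw [sub_eq_iff_eq_add] at hb
        conv_lhs => rw [hb]
        simp only [Fin.sum_univ_castSucc, Fin.snoc_castSucc, Fin.snoc_last, smul_sub, sub_smul,
          Finset.sum_sub_distrib, Finset.sum_smul, smul_smul]
        abel

lemma farkas {K ι : Type*} [Field K] [LinearOrder K] [IsStrictOrderedRing K] [Fintype ι] {n : ℕ}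
    (a : ι → (Fin n → K)) (b : Fin n → K)
    (hb : ¬ ∃ l : ι → K, (∀ i, 0 ≤ l i) ∧ b = ∑ i, l i • a i) :
    ∃ c : Fin n → K, (∀ i, c ⬝ᵥ a i ≤ 0) ∧ 0 < c ⬝ᵥ b := by
  by_contra hcon
  push Not at hcon
  apply hb
  let e := Fintype.equivFin ι
  obtain ⟨l, hl, h⟩ := farkas_fin _ (fun i => a (e.symm i)) b (by
    intro x hx
    rw [dotProduct_comm]
    apply hcon x
    intro i
    have := hx (e i)
    rw [dotProduct_comm]
    simpa using this)
  refine ⟨fun i => l (e i), fun i => hl _, ?_⟩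
  rw [h]
  refine (Fintype.sum_equiv e _ _ ?_).symm
  intro i; simp

lemma facet_step {K ι : Type*} [Field K] [LinearOrder K] [IsStrictOrderedRing K] [Fintype ι]
    {n : ℕ} (a : ι → (Fin n → K)) (b : Fin n → K)
    (hs : ∀ d : Fin n → K, (∀ i, d ⬝ᵥ a i = 0) → d = 0) (c : Fin n → K)
    (hc : ∀ i, c ⬝ᵥ a i ≤ 0) (hb : 0 < c ⬝ᵥ b)
    (hr : Module.finrank K (Submodule.span K (a '' {i | c ⬝ᵥ a i = 0})) + 1 < n) :
    ∃ c' : Fin n → K, (∀ i, c' ⬝ᵥ a i ≤ 0) ∧ 0 < c' ⬝ᵥ b ∧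
      Module.finrank K (Submodule.span K (a '' {i | c ⬝ᵥ a i = 0})) <
      Module.finrank K (Submodule.span K (a '' {i | c' ⬝ᵥ a i = 0})) := by
  set Z := Submodule.span K (a '' {i | c ⬝ᵥ a i = 0}) with hZ
  have hlt : Z ⊔ Submodule.span K {b} < ⊤ := by
    rw [lt_top_iff_ne_top]
    intro htop
    have h1 := Submodule.finrank_add_le_finrank_add_finrank Z (Submodule.span K {b})
    have h2 := finrank_span_le_card (R := K) ({b} : Set (Fin n → K))
    simp only [Set.toFinset_singleton, Finset.card_singleton] at h2
    rw [htop, finrank_top, Module.finrank_fin_fun] at h1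
    omega
  obtain ⟨f, hf0, hf⟩ := Submodule.exists_le_ker_of_lt_top _ hlt
  obtain ⟨d, hd⟩ : ∃ d : Fin n → K, ∀ x, f x = d ⬝ᵥ x := by
    refine ⟨fun i => f (Pi.single i 1), fun x => ?_⟩
    rw [LinearMap.pi_apply_eq_sum_univ f x]
    simp only [dotProduct, smul_eq_mul]
    refine Finset.sum_congr rfl fun i _ => ?_
    rw [mul_comm]
    congr 2
    ext j
    simp [Pi.single_apply, eq_comm]
  have hdb : d ⬝ᵥ b = 0 := by
    rw [← hd]
    exact hf (Submodule.mem_sup_right (Submodule.mem_span_singleton_self b))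
  have hdZ : ∀ x ∈ Z, d ⬝ᵥ x = 0 := fun x hx => by
    rw [← hd]
    exact hf (Submodule.mem_sup_left hx)
  have hd0 : d ≠ 0 := by
    rintro rfl
    apply hf0
    ext x
    simp [hd]
  obtain ⟨d, hdb, hdZ, i1, hi1⟩ : ∃ d : Fin n → K, d ⬝ᵥ b = 0 ∧ (∀ x ∈ Z, d ⬝ᵥ x = 0) ∧
      ∃ i, 0 < d ⬝ᵥ a i := by
    have : ∃ i, d ⬝ᵥ a i ≠ 0 := by
      by_contra hcon
      push Not at hcon
      exact hd0 (hs d hcon)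
    obtain ⟨i, hi⟩ := this
    rcases lt_or_gt_of_ne hi with h | h
    · exact ⟨-d, by simp [hdb], fun x hx => by simp [hdZ x hx], i, by simpa using h⟩
    · exact ⟨d, hdb, hdZ, i, h⟩
  obtain ⟨i0, hi0, hmin⟩ := Finset.exists_min_image (Finset.univ.filter fun i => 0 < d ⬝ᵥ a i)
    (fun i => -(c ⬝ᵥ a i) / (d ⬝ᵥ a i)) ⟨i1, by simpa using hi1⟩
  simp only [Finset.mem_filter, Finset.mem_univ, true_and] at hi0 hmin
  set t := -(c ⬝ᵥ a i0) / (d ⬝ᵥ a i0) with ht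
  have ht0 : 0 ≤ t := div_nonneg (by linarith [hc i0]) hi0.le
  have hval : ∀ x, (c + t • d) ⬝ᵥ x = c ⬝ᵥ x + t * (d ⬝ᵥ x) := fun x => by
    rw [add_dotProduct, smul_dotProduct, smul_eq_mul]
  refine ⟨c + t • d, ?_, ?_, ?_⟩
  · intro i
    rw [hval]
    by_cases hi : 0 < d ⬝ᵥ a i
    · have := hmin i hi
      rw [le_div_iff₀ hi] at this
      linarith
    · have := mul_nonpos_of_nonneg_of_nonpos ht0 (not_lt.1 hi)
      linarith [hc i]
  · rw [hval, hdb]; simpa using hb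
  · apply Submodule.finrank_lt_finrank_of_lt
    refine lt_of_le_of_ne ?_ ?_
    · apply Submodule.span_mono
      apply Set.image_mono
      intro i hi
      simp only [Set.mem_ofPred_eq] at hi ⊢
      rw [hval, hi, hdZ (a i) (Submodule.subset_span ⟨i, hi, rfl⟩)]
      simp
    · intro heq
      have : a i0 ∈ Z := by
        rw [heq]
        apply Submodule.subset_span
        refine ⟨i0, ?_, rfl⟩
        simp only [Set.mem_ofPred_eq]
        rw [hval, ht, div_mul_cancel₀ _ hi0.ne']
        ring
      exact hi0.ne' (hdZ _ this)

lemma facet_exists {K ι : Type*} [Field K] [LinearOrder K] [IsStrictOrderedRing K] [Fintype ι]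
    {n : ℕ} (a : ι → (Fin n → K)) (b : Fin n → K)
    (hs : ∀ d : Fin n → K, (∀ i, d ⬝ᵥ a i = 0) → d = 0)
    (hb : ¬ ∃ l : ι → K, (∀ i, 0 ≤ l i) ∧ b = ∑ i, l i • a i) :
    ∃ c : Fin n → K, (∀ i, c ⬝ᵥ a i ≤ 0) ∧ 0 < c ⬝ᵥ b ∧
      n ≤ Module.finrank K (Submodule.span K (a '' {i | c ⬝ᵥ a i = 0})) + 1 := by
  have key : ∀ k : ℕ, k ≤ n → ∃ c : Fin n → K, (∀ i, c ⬝ᵥ a i ≤ 0) ∧ 0 < c ⬝ᵥ b ∧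
      k ≤ Module.finrank K (Submodule.span K (a '' {i | c ⬝ᵥ a i = 0})) + 1 := by
    intro k
    induction k with
    | zero =>
      intro _
      obtain ⟨c, h1, h2⟩ := farkas a b hb
      exact ⟨c, h1, h2, by omega⟩
    | succ k ih =>
      intro hk
      obtain ⟨c, h1, h2, h3⟩ := ih (by omega)
      by_cases h : k + 1 ≤ Module.finrank K (Submodule.span K (a '' {i | c ⬝ᵥ a i = 0})) + 1
      · exact ⟨c, h1, h2, h⟩
      · obtain ⟨c', h1', h2', h3'⟩ := facet_step a b hs c h1 h2 (by omega)
        exact ⟨c', h1', h2', by omega⟩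
  exact key n le_rfl

lemma clear_denoms {n : ℕ} (c : Fin n → ℚ) : ∃ (N : ℕ) (z : Fin n → ℤ), 0 < N ∧
    ∀ i, (z i : ℚ) = N * c i := by
  refine ⟨∏ i, (c i).den, fun i => (c i).num * ∏ j ∈ Finset.univ.erase i, ((c j).den : ℤ), 
    Finset.prod_pos fun i _ => (c i).den_pos, fun i => ?_⟩
  rw [← Finset.mul_prod_erase _ _ (Finset.mem_univ i)]
  push_cast
  rw [mul_right_comm, Rat.den_mul_eq_num]
  
lemma primitive_scale {n : ℕ} (c : Fin n → ℚ) (hc : c ≠ 0) : ∃ (r : ℚ) (z : Fin n → ℤ), 0 < r ∧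
    Finset.univ.gcd (fun t => (z t).natAbs) = 1 ∧ ∀ i, (z i : ℚ) = r * c i := by
  obtain ⟨N, z, hN, hz⟩ := clear_denoms c
  have hne : ∃ i, z i ≠ 0 := by
    by_contra hcon
    push Not at hcon
    apply hc
    ext i
    have := hz i
    rw [hcon i] at this
    simp at this
    rcases this with h | h
    · omega
    · simpa using h
  obtain ⟨i0, hi0⟩ := hne
  set g := Finset.univ.gcd (fun t => (z t).natAbs) with hg
  have hdvd : ∀ i, (g : ℤ) ∣ z i := fun i => by
    rw [Int.natCast_dvd]; exact Finset.gcd_dvd (Finset.mem_univ i)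
  have hg0 : 0 < g := by
    rw [Nat.pos_iff_ne_zero]
    intro h
    have := hdvd i0
    rw [h] at this
    simp at this
    exact hi0 this
  choose y hy using hdvd
  refine ⟨N / g, y, by positivity, ?_, fun i => ?_⟩
  · have h1 : g = g * Finset.univ.gcd (fun t => (y t).natAbs) := by
      conv_lhs => rw [hg]
      have : (fun t => (z t).natAbs) = fun t => g * (y t).natAbs := by
        ext t; rw [hy t, Int.natAbs_mul]; simp
      rw [this, Finset.gcd_mul_left]; simp
    exact (Nat.mul_eq_left hg0.ne').1 h1.symm
  · have := hz i
    rw [hy i] at this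
    push_cast at this
    field_simp
    linarith

lemma pos_functional {K ι : Type*} [Field K] [LinearOrder K] [IsStrictOrderedRing K] [Fintype ι]
    {n : ℕ} (a : ι → (Fin n → K))
    (h : ∀ i, a i ≠ 0 → ¬ ∃ l : ι → K, (∀ i, 0 ≤ l i) ∧ -a i = ∑ i, l i • a i) :
    ∃ c : Fin n → K, ∀ i, 0 ≤ c ⬝ᵥ a i ∧ (a i ≠ 0 → 0 < c ⬝ᵥ a i) := by
  have h1 : ∀ i, ∃ c : Fin n → K, (∀ j, 0 ≤ c ⬝ᵥ a j) ∧ (a i ≠ 0 → 0 < c ⬝ᵥ a i) := by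
    intro i
    by_cases hi : a i = 0
    · exact ⟨0, by simp, by simp [hi]⟩
    · obtain ⟨c, h1, h2⟩ := farkas a (-a i) (h i hi)
      exact ⟨-c, fun j => by simpa using h1 j, fun _ => by simpa using h2⟩
  choose c hc1 hc2 using h1
  refine ⟨∑ i, c i, fun i => ?_⟩
  rw [sum_dotProduct]
  refine ⟨Finset.sum_nonneg fun j _ => hc1 j i, fun hi => ?_⟩
  exact Finset.sum_pos' (fun j _ => hc1 j i) ⟨i, Finset.mem_univ _, hc2 i hi⟩

lemma hilb_gen {n : ℕ} (K : Set (Fin n → ℝ)) (l : Fin n → ℤ)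
    (hl : ∀ x ∈ K, IsLatticePt x → x ≠ 0 → 0 < ∑ t, (l t : ℝ) * x t) :
    ∀ z ∈ K, IsLatticePt z → z ∈ AddSubmonoid.closure (HilbBasis K) := by
  have hone : ∀ x ∈ K, IsLatticePt x → x ≠ 0 → 1 ≤ ∑ t, (l t : ℝ) * x t := by
    intro x hx hxl hx0
    have hp := hl x hx hxl hx0
    choose y hy using hxl
    simp only [hy] at hp ⊢
    norm_cast at hp ⊢
  have key : ∀ N : ℕ, ∀ z ∈ K, IsLatticePt z → ∑ t, (l t : ℝ) * z t ≤ N →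
      z ∈ AddSubmonoid.closure (HilbBasis K) := by
    intro N
    induction N with
    | zero =>
      intro z hz hzl hN
      by_cases h0 : z = 0
      · rw [h0]; exact zero_mem _
      · have := hl z hz hzl h0
        simp at hN
        linarith
    | succ N ih =>
      intro z hz hzl hN
      by_cases h0 : z = 0
      · rw [h0]; exact zero_mem _
      by_cases hirr : z ∈ HilbBasis K
      · exact AddSubmonoid.subset_closure hirr
      have : ∃ a b : Fin n → ℝ, (a ∈ K ∧ IsLatticePt a) ∧ (b ∈ K ∧ IsLatticePt b) ∧ z = a + b ∧
          a ≠ 0 ∧ b ≠ 0 := by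
        by_contra hcon
        apply hirr
        refine ⟨⟨hz, hzl⟩, h0, fun a b ha hb hab => ?_⟩
        by_contra h
        push Not at h
        exact hcon ⟨a, b, ha, hb, hab, h.1, h.2⟩
      obtain ⟨a, b, ⟨ha, hal⟩, ⟨hb, hbl⟩, rfl, ha0, hb0⟩ := this
      have h1 := hone a ha hal ha0
      have h2 := hone b hb hbl hb0
      have h3 : ∑ t, (l t : ℝ) * (a + b) t = ∑ t, (l t : ℝ) * a t + ∑ t, (l t : ℝ) * b t := by
        simp [mul_add, Finset.sum_add_distrib]
      rw [h3] at hN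
      push_cast at hN
      exact add_mem (ih a ha hal (by linarith)) (ih b hb hbl (by linarith))
  intro z hz hzl
  obtain ⟨N, hN⟩ := exists_nat_ge (∑ t, (l t : ℝ) * z t)
  exact key N z hz hzl hN

lemma coneOf_closed {n k : ℕ} (v : Fin k → (Fin n → ℝ)) : IsClosed (coneOf v) := by
  have : coneOf v = ⋂ c ∈ {c : Fin n → ℝ | ∀ i, c ⬝ᵥ v i ≤ 0}, {x | c ⬝ᵥ x ≤ 0} := by
    ext x
    simp only [Set.mem_iInter, Set.mem_ofPred_eq]
    constructor
    · rintro ⟨l, hl, rfl⟩ c hc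
      rw [dotProduct_sum]
      refine Finset.sum_nonpos fun i _ => ?_
      rw [dotProduct_smul, smul_eq_mul]
      exact mul_nonpos_of_nonneg_of_nonpos (hl i) (hc i)
    · intro h
      by_contra hx
      obtain ⟨c, h1, h2⟩ := farkas v x hx
      exact absurd (h c h1) (not_le.2 h2)
  rw [this]
  refine isClosed_biInter fun c _ => ?_
  refine isClosed_le ?_ continuous_const
  unfold dotProduct
  fun_prop

lemma rank_transfer {n : ℕ} (U : Set (Fin n → ℚ)) (S : Submodule ℝ (Fin n → ℝ))
    (h : ∀ u ∈ U, (fun t => (u t : ℝ)) ∈ S) :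
    Module.finrank ℚ (Submodule.span ℚ U) ≤ Module.finrank ℝ S := by
  obtain ⟨b, hbU, hspan, hli⟩ := exists_linearIndependent ℚ U
  have hfin : Finite b := hli.finite
  have := Fintype.ofFinite b
  rw [← hspan, finrank_span_set_eq_card hli, Set.toFinset_card]
  have hli' := (linearIndependent_algebraMap_comp_iff (S := ℝ)).2 hli
  let g : b → S := fun i => ⟨fun t => ((i : Fin n → ℚ) t : ℝ), h _ (hbU i.2)⟩
  have hg : LinearIndependent ℝ g := LinearIndependent.of_comp S.subtype hli'
  exact hg.fintype_card_le_finrank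

/-- A point `y` of the cone that leaves the cone immediately in direction `w`
lies on a facet visible from `w`. -/
lemma facet_visible {n m : ℕ} (v : Fin m → (Fin n → ℤ)) (w : Fin n → ℤ)
    (C' : Set (Fin n → ℝ))
    (hC' : C' = coneOf (fun i t => ((v i t : ℤ) : ℝ)))
    (hfull : Submodule.span ℝ C' = ⊤) (y : Fin n → ℝ) (hy : y ∈ C')
    (hleave : ∀ ε : ℝ, 0 < ε → y + ε • (fun t => ((w t : ℤ) : ℝ)) ∉ C') :
    ∃ c : Fin n → ℤ, IsFacetNormal C' c ∧ 0 < ∑ t, c t * w t ∧ ∑ t, (c t : ℝ) * y t = 0 := by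
  have hy' := hy
  rw [hC'] at hy'
  obtain ⟨lam, hlam, hysum⟩ := hy'
  have hvC : ∀ i, (fun t => ((v i t : ℤ) : ℝ)) ∈ C' := fun i => by
    rw [hC']
    refine ⟨Pi.single i 1, fun j => ?_, ?_⟩
    · by_cases h : j = i <;> simp [Pi.single_apply, h]
    · simp [Pi.single_apply, Finset.sum_ite_eq]
  have hneg : ∀ c : Fin n → ℝ, (∀ i, ∑ t, c t * (v i t : ℝ) ≤ 0) → ∀ x ∈ C',
      ∑ t, c t * x t ≤ 0 := by
    intro c hc x hx
    rw [hC'] at hx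
    obtain ⟨l, hl, rfl⟩ := hx
    change c ⬝ᵥ _ ≤ 0
    rw [dotProduct_sum]
    refine Finset.sum_nonpos fun i _ => ?_
    rw [dotProduct_smul, smul_eq_mul]
    exact mul_nonpos_of_nonneg_of_nonpos (hl i) (hc i)
  -- the tangent cone at `y`
  let a : Fin m ⊕ Fin m → (Fin n → ℚ) := Sum.elim (fun i t => (v i t : ℚ))
    (fun i => if 0 < lam i then fun t => -(v i t : ℚ) else 0)
  have hs : ∀ d : Fin n → ℚ, (∀ i, d ⬝ᵥ a i = 0) → d = 0 := by
    intro d hd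
    have h1 : ∀ i, ∑ t, (d t : ℝ) * (v i t : ℝ) = 0 := fun i => by
      have := hd (Sum.inl i)
      simp only [a, Sum.elim_inl, dotProduct] at this
      exact_mod_cast this
    let dr : Fin n → ℝ := fun t => (d t : ℝ)
    have h2 : ∀ x : Fin n → ℝ, dr ⬝ᵥ x = 0 := by
      intro x
      have hx : x ∈ Submodule.span ℝ C' := by rw [hfull]; trivial
      induction hx using Submodule.span_induction with
      | mem x hx =>
        apply le_antisymm
        · exact hneg dr (fun i => (h1 i).le) x hx
        · have := hneg (fun t => - dr t) (fun i => by simp [dr, h1 i]) x hx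
          simpa [dotProduct] using this
      | zero => simp
      | add x y _ _ hx hy => rw [dotProduct_add, hx, hy, add_zero]
      | smul r x _ hx => rw [dotProduct_smul, hx, smul_zero]
    have h3 : dr = 0 := dotProduct_self_eq_zero.1 (h2 dr)
    ext t
    have := congrFun h3 t
    simpa [dr] using this
  have hb : ¬ ∃ l : Fin m ⊕ Fin m → ℚ, (∀ i, 0 ≤ l i) ∧
      (fun t => (w t : ℚ)) = ∑ i, l i • a i := by
    rintro ⟨l, hl, hw⟩
    -- choose ε
    obtain ⟨ε, hε, hεl⟩ : ∃ ε : ℝ, 0 < ε ∧ ∀ i, 0 < lam i → ε * (l (Sum.inr i) : ℝ) ≤ lam i := by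
      have : ∀ i, ∃ ε : ℝ, 0 < ε ∧ (0 < lam i → ∀ δ, 0 ≤ δ → δ ≤ ε →
          δ * (l (Sum.inr i) : ℝ) ≤ lam i) := by
        intro i
        by_cases h : 0 < lam i
        · have hl0 : (0 : ℝ) ≤ (l (Sum.inr i) : ℝ) := by exact_mod_cast hl _
          refine ⟨lam i / ((l (Sum.inr i) : ℝ) + 1), by positivity, fun _ δ hδ0 hδ => ?_⟩
          rw [le_div_iff₀ (by positivity)] at hδ
          nlinarith
        · exact ⟨1, one_pos, fun h' => absurd h' h⟩
      choose e he he' using this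
      by_cases hm : Nonempty (Fin m)
      · obtain ⟨i0, -, hmin⟩ := Finset.exists_min_image Finset.univ e Finset.univ_nonempty
        exact ⟨e i0, he i0, fun i hi => he' i hi _ (he i0).le (hmin i (Finset.mem_univ _))⟩
      · exact ⟨1, one_pos, fun i => absurd ⟨i⟩ hm⟩
    apply hleave ε hε
    rw [hC']
    refine ⟨fun i => lam i + ε * (l (Sum.inl i) : ℝ) -
      ε * (if 0 < lam i then (l (Sum.inr i) : ℝ) else 0), fun i => ?_, ?_⟩
    · have hl0 : (0 : ℝ) ≤ (l (Sum.inl i) : ℝ) := by exact_mod_cast hl _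
      have := mul_nonneg hε.le hl0
      beta_reduce
      split_ifs with h
      · linarith [hεl i h]
      · linarith [hlam i]
    · have hwr : ∀ t, (w t : ℝ) = ∑ i, (l (Sum.inl i) : ℝ) * (v i t : ℝ) -
          ∑ i, (if 0 < lam i then (l (Sum.inr i) : ℝ) else 0) * (v i t : ℝ) := by
        intro t
        have h1 := congrFun hw t
        have h2 : (w t : ℚ) = ∑ i, l (Sum.inl i) * (v i t : ℚ) -
            ∑ i, (if 0 < lam i then l (Sum.inr i) else 0) * (v i t : ℚ) := by
          rw [h1, Fintype.sum_sum_type, Pi.add_apply, Finset.sum_apply, Finset.sum_apply,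
            sub_eq_add_neg, ← Finset.sum_neg_distrib]
          congr 1
          refine Finset.sum_congr rfl fun i _ => ?_
          simp only [a, Sum.elim_inr]
          split_ifs <;> simp
        have h3 : ((w t : ℚ) : ℝ) = _ := congrArg (fun q : ℚ => (q : ℝ)) h2
        push_cast at h3
        simpa [apply_ite] using h3
      ext t
      rw [Pi.add_apply, Pi.smul_apply, hwr, hysum]
      simp only [Finset.sum_apply, Pi.smul_apply, smul_eq_mul, mul_sub, Finset.mul_sum]
      rw [← Finset.sum_sub_distrib, ← Finset.sum_add_distrib]
      refine Finset.sum_congr rfl fun i _ => ?_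
      ring
  obtain ⟨c, hc1, hc2, hc3⟩ := facet_exists a _ hs hb
  have hc0 : c ≠ 0 := by rintro rfl; simp at hc2
  obtain ⟨r, z, hr, hgcd, hz⟩ := primitive_scale c hc0
  have hzr : ∀ t, (z t : ℝ) = (r : ℝ) * (c t : ℝ) := fun t => by exact_mod_cast congrArg (fun q : ℚ => (q : ℝ)) (hz t)
  have hzv : ∀ i, (∑ t, (z t : ℝ) * (v i t : ℝ)) = (r : ℝ) * ((c ⬝ᵥ a (Sum.inl i) : ℚ) : ℝ) := by
    intro i
    simp only [a, Sum.elim_inl, dotProduct, hzr]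
    push_cast
    rw [Finset.mul_sum]
    refine Finset.sum_congr rfl fun t _ => by ring
  have hzv0 : ∀ i, ∑ t, (z t : ℝ) * (v i t : ℝ) ≤ 0 := fun i => by
    rw [hzv]
    refine mul_nonpos_of_nonneg_of_nonpos (by exact_mod_cast hr.le) (by exact_mod_cast hc1 _)
  have hca : ∀ i, 0 < lam i → c ⬝ᵥ a (Sum.inl i) = 0 := by
    intro i hi
    apply le_antisymm (hc1 _)
    have h := hc1 (Sum.inr i)
    simp only [a, Sum.elim_inr, hi, if_true, dotProduct] at h
    simp only [a, Sum.elim_inl, dotProduct]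
    simpa using h
  have hz0 : z ≠ 0 := by
    rintro rfl
    simp at hgcd
    obtain ⟨t, ht⟩ := Function.ne_iff.1 hc0
    have := hz t
    simp at this
    rcases this with h | h
    · exact hr.ne' h
    · exact ht h
  have hnpos : 0 < n := by
    obtain ⟨t, ht⟩ := Function.ne_iff.1 hc0
    exact t.pos
  refine ⟨z, ⟨hgcd, hneg _ hzv0, ?_⟩, ?_, ?_⟩
  · set S := Submodule.span ℝ {x | x ∈ C' ∧ ∑ t, (z t : ℝ) * x t = 0} with hS
    have hmemS : ∀ i, c ⬝ᵥ a (Sum.inl i) = 0 → (fun t => (v i t : ℝ)) ∈ S := fun i hi =>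
      Submodule.subset_span ⟨hvC i, by rw [hzv, hi]; simp⟩
    have hge : n ≤ Module.finrank ℝ S + 1 := by
      refine hc3.trans (Nat.add_le_add_right (rank_transfer _ S ?_) 1)
      rintro _ ⟨i | i, hi, rfl⟩
      · simpa [a] using hmemS i hi
      · by_cases h : 0 < lam i
        · have := S.neg_mem (hmemS i (hca i h))
          convert this using 1
          ext t
          simp [a, h]
        · convert S.zero_mem using 1
          ext t
          simp [a, h]
    have hlt : Module.finrank ℝ S < n := by
      have hne : S ≠ ⊤ := by
        intro htop
        have h2 : ∀ x : Fin n → ℝ, (fun t => (z t : ℝ)) ⬝ᵥ x = 0 := by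
          intro x
          have hx : x ∈ S := by rw [htop]; trivial
          induction hx using Submodule.span_induction with
          | mem x hx => exact hx.2
          | zero => simp
          | add x y _ _ hx hy => rw [dotProduct_add, hx, hy, add_zero]
          | smul r x _ hx => rw [dotProduct_smul, hx, smul_zero]
        apply hz0
        ext t
        have := congrFun (dotProduct_self_eq_zero.1 (h2 _)) t
        simpa using this
      have := Submodule.finrank_lt hne
      simpa using this
    omega
  · have : (∑ t, (z t : ℚ) * (w t : ℚ)) = r * (c ⬝ᵥ fun t => (w t : ℚ)) := by
      simp only [dotProduct, hz, Finset.mul_sum, mul_assoc]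
    have h2 : 0 < ∑ t, (z t : ℚ) * (w t : ℚ) := by rw [this]; exact mul_pos hr hc2
    exact_mod_cast h2
  · change (fun t => (z t : ℝ)) ⬝ᵥ y = 0
    rw [hysum, dotProduct_sum]
    refine Finset.sum_eq_zero fun i _ => ?_
    rw [dotProduct_smul, smul_eq_mul]
    by_cases h : 0 < lam i
    · have := hzv i
      rw [hca i h] at this
      simp only [dotProduct]
      rw [this]; simp
    · rw [le_antisymm (not_lt.1 h) (hlam i), zero_mul]

lemma exists_pos_lattice {n m : ℕ} (v : Fin m → (Fin n → ℤ)) (w : Fin n → ℤ)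
    (C' C : Set (Fin n → ℝ))
    (hC' : C' = coneOf (fun i t => ((v i t : ℤ) : ℝ)))
    (hC : C = addRay C' (fun t => ((w t : ℤ) : ℝ)))
    (hpointed : ∀ x ∈ C, -x ∈ C → x = 0) :
    ∃ l : Fin n → ℤ, ∀ x ∈ C, x ≠ 0 → 0 < ∑ t, (l t : ℝ) * x t := by
  let a : Option (Fin m) → (Fin n → ℤ) := fun o => o.elim w v
  have hmem : ∀ x, x ∈ C ↔ ∃ l : Option (Fin m) → ℝ, (∀ i, 0 ≤ l i) ∧
      x = ∑ i, l i • (fun t => (a i t : ℝ)) := by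
    intro x
    rw [hC, hC']
    constructor
    · rintro ⟨_, ⟨l, hl, rfl⟩, μ, hμ, rfl⟩
      refine ⟨fun o => o.elim μ l, ?_, ?_⟩
      · rintro (_ | i)
        · exact hμ
        · exact hl i
      · rw [Fintype.sum_option, add_comm]; rfl
    · rintro ⟨l, hl, rfl⟩
      refine ⟨_, ⟨fun i => l (some i), fun i => hl _, rfl⟩, l none, hl _, ?_⟩
      rw [Fintype.sum_option, add_comm]; rfl
  obtain ⟨c, hc⟩ := pos_functional (fun o t => (a o t : ℚ)) (by
    rintro i hi ⟨l, hl, h⟩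
    apply hi
    have h0 : (fun t => (a i t : ℝ)) = 0 := by
      apply hpointed
      · rw [hmem]
        refine ⟨Pi.single i 1, fun j => ?_, ?_⟩
        · by_cases h : j = i <;> simp [Pi.single_apply, h]
        · simp [Pi.single_apply, Finset.sum_ite_eq]
      · rw [hmem]
        refine ⟨fun j => (l j : ℝ), fun j => Rat.cast_nonneg.2 (hl j), ?_⟩
        ext t
        have := congrArg (fun q : ℚ => (q : ℝ)) (congrFun h t)
        simpa [Finset.sum_apply] using this
    ext t
    have := congrFun h0 t
    simpa using this)
  obtain ⟨N, z, hN, hz⟩ := clear_denoms c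
  have hza : ∀ i, (fun t => (z t : ℝ)) ⬝ᵥ (fun t => (a i t : ℝ)) =
      (N : ℝ) * ((c ⬝ᵥ (fun t => (a i t : ℚ)) : ℚ) : ℝ) := by
    intro i
    have : ∀ t, (z t : ℝ) = (N : ℝ) * (c t : ℝ) := fun t => by
      exact_mod_cast congrArg (fun q : ℚ => (q : ℝ)) (hz t)
    simp only [dotProduct, this]
    push_cast
    rw [Finset.mul_sum]
    exact Finset.sum_congr rfl fun t _ => by ring
  have hN' : (0 : ℝ) < N := by exact_mod_cast hN
  refine ⟨z, fun x hx hx0 => ?_⟩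
  obtain ⟨l, hl, rfl⟩ := (hmem x).1 hx
  change 0 < (fun t => (z t : ℝ)) ⬝ᵥ _
  rw [dotProduct_sum]
  have hnn : ∀ i, 0 ≤ (fun t => (z t : ℝ)) ⬝ᵥ (l i • fun t => (a i t : ℝ)) := by
    intro i
    rw [dotProduct_smul, smul_eq_mul, hza]
    exact mul_nonneg (hl i) (mul_nonneg hN'.le (by exact_mod_cast (hc i).1))
  obtain ⟨i, -, hi⟩ := Finset.exists_ne_zero_of_sum_ne_zero hx0
  refine Finset.sum_pos' (fun i _ => hnn i) ⟨i, Finset.mem_univ _, ?_⟩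
  rw [dotProduct_smul, smul_eq_mul, hza]
  have hli : l i ≠ 0 := by rintro h; simp [h] at hi
  have hai : (fun t => (a i t : ℚ)) ≠ 0 := by
    intro h
    apply hi
    ext t
    have := congrFun h t
    simp at this
    simp [this]
  exact mul_pos (lt_of_le_of_ne (hl i) hli.symm) (mul_pos hN' (by exact_mod_cast (hc i).2 hai))

theorem stmt3 {n m q : ℕ} (v : Fin m → (Fin n → ℤ)) (w : Fin n → ℤ)
    (C' C : Set (Fin n → ℝ))
    (hC' : C' = coneOf (fun i t => ((v i t : ℤ) : ℝ)))
    (hC : C = addRay C' (fun t => ((w t : ℤ) : ℝ)))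
    (hfull : Submodule.span ℝ C' = ⊤)
    (hwnot : (fun t => ((w t : ℤ) : ℝ)) ∉ C')
    (hpointed : ∀ x ∈ C, -x ∈ C → x = 0)
    (cf : Fin q → (Fin n → ℤ))
    (F : Fin q → Set (Fin n → ℝ))
    (hF : ∀ i, F i = {x | x ∈ C' ∧ ∑ t, (cf i t : ℝ) * x t = 0})
    (hfacets : ∀ i, IsFacetNormal C' (cf i))
    (hvisible : ∀ i, 0 < ∑ t, cf i t * w t)
    (hall : ∀ c : Fin n → ℤ, IsFacetNormal C' c → 0 < ∑ t, c t * w t → ∃ i, c = cf i) :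
    ∀ z ∈ C, IsLatticePt z →
      z ∈ AddSubmonoid.closure
        (HilbBasis C' ∪ {fun t => ((w t : ℤ) : ℝ)} ∪
          ⋃ i ∈ {i : Fin q | 2 ≤ |∑ t, cf i t * w t|},
            HilbBasis (addRay (F i) (fun t => ((w t : ℤ) : ℝ)))) := by
  intro z hz hzl
  obtain ⟨l, hl⟩ := exists_pos_lattice v w C' C hC' hC hpointed
  set wr : Fin n → ℝ := fun t => ((w t : ℤ) : ℝ) with hwr
  have hsub : C' ⊆ C := fun x hx => by
    rw [hC]; exact ⟨x, hx, 0, le_rfl, by simp⟩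
  have hC'gen : ∀ x ∈ C', IsLatticePt x → x ∈ AddSubmonoid.closure (HilbBasis C') :=
    hilb_gen C' l (fun x hx _ hx0 => hl x (hsub hx) hx0)
  by_cases hzC : z ∈ C'
  · refine AddSubmonoid.closure_mono ?_ (hC'gen z hzC hzl)
    exact fun x hx => Or.inl (Or.inl hx)
  -- the last point of C' on the ray from z in direction -w
  let T : Set ℝ := {μ | 0 ≤ μ ∧ z - μ • wr ∈ C'}
  have hTne : T.Nonempty := by
    rw [hC] at hz
    obtain ⟨x, hx, μ, hμ, rfl⟩ := hz
    exact ⟨μ, hμ, by simpa using hx⟩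
  have hTbdd : BddBelow T := ⟨0, fun μ hμ => hμ.1⟩
  have hTcl : IsClosed T := by
    have h1 : IsClosed C' := by rw [hC']; exact coneOf_closed _
    have h2 : Continuous fun μ : ℝ => z - μ • wr := by fun_prop
    exact isClosed_Ici.inter (h1.preimage h2)
  obtain ⟨hμ0, hyC⟩ := hTcl.csInf_mem hTne hTbdd
  have hmin : ∀ μ ∈ T, sInf T ≤ μ := fun μ hμ => csInf_le hTbdd hμ
  set μ := sInf T with hμ
  set y := z - μ • wr with hy
  have hleave : ∀ ε : ℝ, 0 < ε → y + ε • wr ∉ C' := by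
    intro ε hε hcon
    have heq : y + ε • wr = z - (μ - ε) • wr := by rw [hy, sub_smul]; abel
    by_cases h : 0 ≤ μ - ε
    · have := hmin (μ - ε) ⟨h, heq ▸ hcon⟩
      linarith
    · push Not at h
      -- z is a convex combination of two points of C'
      apply hzC
      have hs : 0 < ε := hε
      have hz' : z = ((ε - μ) / ε) • y + (μ / ε) • (y + ε • wr) := by
        ext t
        simp only [hy, Pi.add_apply, Pi.sub_apply, Pi.smul_apply, smul_eq_mul]
        field_simp
        ring
      rw [hz']
      rw [hC'] at hyC hcon ⊢
      obtain ⟨l1, hl1, h1⟩ := hyC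
      obtain ⟨l2, hl2, h2⟩ := hcon
      refine ⟨fun i => (ε - μ) / ε * l1 i + μ / ε * l2 i, fun i => ?_, ?_⟩
      · have := hl1 i
        have := hl2 i
        have : 0 ≤ ε - μ := by linarith
        positivity
      · rw [h2, h1]
        simp only [Finset.smul_sum, smul_smul, add_smul, Finset.sum_add_distrib]
  obtain ⟨c, hcf, hcw, hcy⟩ := facet_visible v w C' hC' hfull y hyC hleave
  obtain ⟨i, rfl⟩ := hall c hcf hcw
  have hyF : y ∈ F i := by rw [hF]; exact ⟨hyC, hcy⟩
  have hzy : z = y + μ • wr := by rw [hy]; abel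
  by_cases h2 : 2 ≤ |∑ t, cf i t * w t|
  · have hzK : z ∈ addRay (F i) wr := ⟨y, hyF, μ, hμ0, hzy⟩
    have hKC : addRay (F i) wr ⊆ C := by
      rintro _ ⟨x, hx, s, hs, rfl⟩
      rw [hF] at hx
      rw [hC]
      exact ⟨x, hx.1, s, hs, rfl⟩
    refine AddSubmonoid.closure_mono ?_
      (hilb_gen (addRay (F i) wr) l (fun x hx _ hx0 => hl x (hKC hx) hx0) z hzK hzl)
    intro x hx
    refine Or.inr ?_
    exact Set.mem_biUnion (show i ∈ {i : Fin q | 2 ≤ |∑ t, cf i t * w t|} from h2) hx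
  · have hone : ∑ t, cf i t * w t = 1 := by
      rw [abs_of_pos hcw] at h2
      omega
    have honeR : ∑ t, (cf i t : ℝ) * wr t = 1 := by
      simp only [hwr]; exact_mod_cast hone
    choose zi hzi using hzl
    have hμint : μ = ((∑ t, cf i t * zi t : ℤ) : ℝ) := by
      have : ∑ t, (cf i t : ℝ) * z t = μ := by
        have h3 : ∑ t, (cf i t : ℝ) * z t =
            ∑ t, (cf i t : ℝ) * y t + μ * ∑ t, (cf i t : ℝ) * wr t := by
          rw [Finset.mul_sum, ← Finset.sum_add_distrib]
          refine Finset.sum_congr rfl fun t _ => ?_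
          rw [hzy]
          simp only [Pi.add_apply, Pi.smul_apply, smul_eq_mul]
          ring
        rw [h3, hcy, honeR]; ring
      rw [← this]
      push_cast
      exact Finset.sum_congr rfl fun t _ => by rw [hzi]
    obtain ⟨N, hN⟩ : ∃ N : ℕ, μ = N := by
      have h0 : 0 ≤ ∑ t, cf i t * zi t := by
        rw [hμint] at hμ0; exact_mod_cast hμ0
      refine ⟨(∑ t, cf i t * zi t).toNat, ?_⟩
      rw [hμint]
      exact_mod_cast (Int.toNat_of_nonneg h0).symm
    have hyl : IsLatticePt y := fun t => ⟨zi t - N * w t, by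
      simp [hy, hN, hzi, hwr]⟩
    have hyg := hC'gen y hyC hyl
    rw [hzy, hN, Nat.cast_smul_eq_nsmul]
    refine add_mem (AddSubmonoid.closure_mono (fun x hx => Or.inl (Or.inl hx)) hyg) ?_
    refine nsmul_mem (AddSubmonoid.subset_closure ?_) N
    exact Or.inl (Or.inr rfl)
end

section
/- Consider 6×4×3 contingency tables: the linear map A : ℝ^{72} → ℝ^{6+4+3·... } taking a table (z_{ijk}) with 1 ≤ i ≤ 6, 1 ≤ j ≤ 4, 1 ≤ k ≤ 3 to its three families of line sums (Σ_i z_{ijk})_{j,k}, (Σ_j z_{ijk})_{i,k}, (Σ_k z_{ijk})_{i,j}. Let f be the right-hand side given by the 4×3 all-ones matrix for the (j,k)-marginals, the 6×3 matrix with rows (1,1,0),(1,1,0),(1,0,1),(1,0,1),(0,1,1),(0,1,1) for the (i,k)-marginals, and the 6×4 matrix with rows (1,0,0,1),(0,1,1,0),(1,1,0,0),(0,0,1,1),(1,0,1,0),(0,1,0,1) for the (i,j)-marginals. Then the transportation polytope {z ∈ ℝ^{72} : Az = f, z ≥ 0} consists of a single point z*, and z* has some non-integer coordinates (each nonzero coordinate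 equals 1/2). -/
/-- 6×4×3 contingency tables with entries in `α`. -/
abbrev Tab643 (α : Type) := Fin 6 → Fin 4 → Fin 3 → α

/-- The `(j,k)`-marginals (sums over the first index). -/
def margJK (z : Tab643 ℝ) : Fin 4 → Fin 3 → ℝ := fun j k => ∑ i, z i j k

/-- The `(i,k)`-marginals (sums over the second index). -/
def margIK (z : Tab643 ℝ) : Fin 6 → Fin 3 → ℝ := fun i k => ∑ j, z i j k

/-- The `(i,j)`-marginals (sums over the third index). -/
def margIJ (z : Tab643 ℝ) : Fin 6 → Fin 4 → ℝ := fun i j => ∑ k, z i j k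

/-- Vlach's right-hand side: the `(j,k)`-marginals. -/
def f1 : Fin 4 → Fin 3 → ℝ := fun _ _ => 1

/-- Vlach's right-hand side: the `(i,k)`-marginals. -/
def f2 : Fin 6 → Fin 3 → ℝ :=
  ![![1,1,0], ![1,1,0], ![1,0,1], ![1,0,1], ![0,1,1], ![0,1,1]]

/-- Vlach's right-hand side: the `(i,j)`-marginals. -/
def f3 : Fin 6 → Fin 4 → ℝ :=
  ![![1,0,0,1], ![0,1,1,0], ![1,1,0,0], ![0,0,1,1], ![1,0,1,0], ![0,1,0,1]]

/-- Membership in the transportation polytope `{z ≥ 0 : Az = f}`. -/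
def VlachFeas (z : Tab643 ℝ) : Prop :=
  (∀ i j k, 0 ≤ z i j k) ∧ margJK z = f1 ∧ margIK z = f2 ∧ margIJ z = f3


set_option maxHeartbeats 4000000 in
theorem vlach_unique (z : Tab643 ℝ) (h : VlachFeas z) :
    z = fun i j k => f2 i k * f3 i j / 2 := by
  obtain ⟨h0, h1, h2, h3⟩ := h
  have z2 : ∀ i j k, f2 i k = 0 → z i j k = 0 := by
    intro i j k hf
    have e : ∑ j, z i j k = 0 := (congrFun (congrFun h2 i) k).trans hf
    exact (Finset.sum_eq_zero_iff_of_nonneg (fun j _ => h0 i j k)).1 e j (Finset.mem_univ j)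
  have z3 : ∀ i j k, f3 i j = 0 → z i j k = 0 := by
    intro i j k hf
    have e : ∑ k, z i j k = 0 := (congrFun (congrFun h3 i) j).trans hf
    exact (Finset.sum_eq_zero_iff_of_nonneg (fun k _ => h0 i j k)).1 e k (Finset.mem_univ k)
  have e1 : ∀ j k, ∑ i, z i j k = 1 := fun j k => congrFun (congrFun h1 j) k
  have e2 : ∀ i k, ∑ j, z i j k = f2 i k := fun i k => congrFun (congrFun h2 i) k
  have e3 : ∀ i j, ∑ k, z i j k = f3 i j := fun i j => congrFun (congrFun h3 i) j
  simp [f2, f3, Fin.forall_fin_succ, Fin.sum_univ_succ] at z2 z3 e1 e2 e3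
  simp only [z2, z3] at e1 e2 e3
  clear h1 h2 h3 h0
  funext i j k
  fin_cases i <;> fin_cases j <;> fin_cases k <;> simp [f2, f3, z2, z3] <;> linarith

theorem vlach_feas : VlachFeas (fun i j k => f2 i k * f3 i j / 2) := by
  refine ⟨?_, ?_, ?_, ?_⟩
  · intro i j k
    fin_cases i <;> fin_cases j <;> fin_cases k <;> simp [f2, f3]
  · funext j k
    fin_cases j <;> fin_cases k <;> simp [margJK, f1, f2, f3, Fin.sum_univ_succ] <;> norm_num
  · funext i k
    fin_cases i <;> fin_cases k <;> simp [margIK, f2, f3, Fin.sum_univ_succ] <;> norm_num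
  · funext i j
    fin_cases i <;> fin_cases j <;> simp [margIJ, f2, f3, Fin.sum_univ_succ] <;> norm_num

theorem stmt4 :
    (∃! z : Tab643 ℝ, VlachFeas z) ∧
    ∀ z : Tab643 ℝ, VlachFeas z →
      ((∀ i j k, z i j k = 0 ∨ z i j k = 1 / 2) ∧
        ∃ i j k, ∀ m : ℤ, z i j k ≠ (m : ℝ)) := by
  refine ⟨⟨_, vlach_feas, fun z hz => vlach_unique z hz⟩, ?_⟩
  intro z hz
  rw [vlach_unique z hz]
  refine ⟨?_, 0, 0, 0, ?_⟩
  · intro i j k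
    fin_cases i <;> fin_cases j <;> fin_cases k <;> simp [f2, f3]
  · intro m hm
    have h : (1 : ℝ) = ((2 * m : ℤ) : ℝ) := by
      simp [f2, f3] at hm
      push_cast
      linarith
    have h' : (1 : ℤ) = 2 * m := by exact_mod_cast h
    omega
end
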